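/- arXiv:2101.02095 — 4 statements merged into one kernel-verified Lean document; each statement's English description precedes it below -/
import Mathlib

section
/- Let G be a non-complete strictly chordal graph. Then sc(G) = 0 if and only if τ(G) = 1. -/
open SimpleGraph

variable {V : Type*}

noncomputable def numComp (G : SimpleGraph V) (S : Set V) : ℕ :=
  Nat.card (G.induce Sᶜ).ConnectedComponent

def SeparatedBy (G : SimpleGraph V) (S : Set V) (u v : V) : Prop :=
  ∃ (hu : u ∈ Sᶜ) (hv : v ∈ Sᶜ), ¬ (G.induce Sᶜ).Reachable ⟨u, hu⟩ ⟨v, hv⟩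

def IsSeparator (G : SimpleGraph V) (S : Set V) : Prop :=
  ∃ u v, G.Reachable u v ∧ SeparatedBy G S u v

def IsMinimalSeparator (G : SimpleGraph V) (S : Set V) : Prop :=
  IsSeparator G S ∧ ∀ T ⊂ S, ¬ IsSeparator G T

def IsMVS (G : SimpleGraph V) (S : Set V) : Prop :=
  ∃ u v, u ≠ v ∧ ¬ G.Adj u v ∧ SeparatedBy G S u v ∧ ∀ T ⊂ S, ¬ SeparatedBy G T u v

def IsChordal (G : SimpleGraph V) : Prop :=
  ∀ n, 4 ≤ n → IsEmpty (cycleGraph n ↪g G)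

def StrictlyChordal (G : SimpleGraph V) : Prop :=
  G.Connected ∧ IsChordal G ∧
    ∀ S S' : Set V, IsMVS G S → IsMVS G S' → S ≠ S' → Disjoint S S'

noncomputable def sc [Finite V] (G : SimpleGraph V) : ℤ :=
  sSup {k : ℤ | ∃ S : Set V, numComp G S ≠ 1 ∧ k = (numComp G S : ℤ) - (Nat.card S : ℤ)}

noncomputable def toughness [Finite V] (G : SimpleGraph V) : ℝ :=
  sInf {t : ℝ | ∃ S : Set V, 1 < numComp G S ∧ t = (Nat.card S : ℝ) / (numComp G S : ℝ)}

def IsScatteringSet [Finite V] (G : SimpleGraph V) (S : Set V) : Prop :=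
  numComp G S ≠ 1 ∧ (numComp G S : ℤ) - (Nat.card S : ℤ) = sc G

def IsMaxClique (G : SimpleGraph V) (Q : Set V) : Prop :=
  G.IsClique Q ∧ ∀ R : Set V, G.IsClique R → Q ⊆ R → Q = R

def IsSimplicial (G : SimpleGraph V) (v : V) : Prop :=
  G.IsClique (G.neighborSet v)

def IsBoundaryClique (G : SimpleGraph V) (Q : Set V) : Prop :=
  IsMaxClique G Q ∧ (∃ v ∈ Q, IsSimplicial G v) ∧
    ∃ Q' : Set V, IsMaxClique G Q' ∧ Q' ≠ Q ∧ Q ∩ Q' = {v | v ∈ Q ∧ ¬ IsSimplicial G v}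

def BS (G : SimpleGraph V) (S : Set V) : Set (Set V) :=
  {Q | IsBoundaryClique G Q ∧ S ⊆ Q}

theorem numComp_univ (G : SimpleGraph V) : numComp G Set.univ = 0 := by
  have : IsEmpty ↥(Set.univᶜ : Set V) := by simp
  have : IsEmpty (G.induce (Set.univᶜ : Set V)).ConnectedComponent :=
    Quot.instIsEmpty
  exact Nat.card_of_isEmpty

theorem eq_univ_of_numComp_eq_zero [Finite V] (G : SimpleGraph V) {S : Set V}
    (h : numComp G S = 0) : S = Set.univ := by
  by_contra hS
  obtain ⟨v, hv⟩ := (Set.ne_univ_iff_exists_notMem S).mp hS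
  have : Nonempty (G.induce Sᶜ).ConnectedComponent :=
    ⟨(G.induce Sᶜ).connectedComponentMk ⟨v, hv⟩⟩
  have : Finite (G.induce Sᶜ).ConnectedComponent := Quot.finite _
  exact Nat.card_pos.ne' h

theorem isGreatest_sc [Finite V] (G : SimpleGraph V) :
    IsGreatest {k : ℤ | ∃ S : Set V, numComp G S ≠ 1 ∧
      k = (numComp G S : ℤ) - (Nat.card S : ℤ)} (sc G) := by
  have hfin : {k : ℤ | ∃ S : Set V, numComp G S ≠ 1 ∧
      k = (numComp G S : ℤ) - (Nat.card S : ℤ)}.Finite :=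
    (Set.finite_range fun S : Set V => (numComp G S : ℤ) - (Nat.card S : ℤ)).subset
      fun _ ⟨S, _, hk⟩ => ⟨S, hk.symm⟩
  have hne : {k : ℤ | ∃ S : Set V, numComp G S ≠ 1 ∧
      k = (numComp G S : ℤ) - (Nat.card S : ℤ)}.Nonempty :=
    ⟨_, Set.univ, by simp [numComp_univ], rfl⟩
  exact ⟨hne.csSup_mem hfin, fun _ hk => le_csSup hfin.bddAbove hk⟩

theorem isLeast_toughness [Finite V] (G : SimpleGraph V)
    (hne : ∃ S : Set V, 1 < numComp G S) :
    IsLeast {t : ℝ | ∃ S : Set V, 1 < numComp G S ∧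
      t = (Nat.card S : ℝ) / (numComp G S : ℝ)} (toughness G) := by
  have hfin : {t : ℝ | ∃ S : Set V, 1 < numComp G S ∧
      t = (Nat.card S : ℝ) / (numComp G S : ℝ)}.Finite :=
    (Set.finite_range fun S : Set V => (Nat.card S : ℝ) / (numComp G S : ℝ)).subset
      fun _ ⟨S, _, ht⟩ => ⟨S, ht.symm⟩
  obtain ⟨S, hS⟩ := hne
  exact ⟨Set.Nonempty.csInf_mem ⟨_, S, hS, rfl⟩ hfin, fun _ ht => csInf_le hfin.bddBelow ht⟩

theorem sc_eq_zero_iff [Finite V] [Nonempty V] (G : SimpleGraph V) :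
    sc G = 0 ↔ (∃ S : Set V, 1 < numComp G S ∧ Nat.card S = numComp G S) ∧
      ∀ S : Set V, 1 < numComp G S → numComp G S ≤ Nat.card S := by
  constructor
  · intro h
    obtain ⟨⟨S, hS, hk⟩, hub⟩ := h ▸ isGreatest_sc G
    refine ⟨⟨S, ?_, by omega⟩, fun T hT => ?_⟩
    · have hS0 : numComp G S ≠ 0 := fun h0 => by
        obtain rfl := eq_univ_of_numComp_eq_zero G h0
        have : 0 < Nat.card (Set.univ : Set V) := Nat.card_pos
        omega
      omega
    · have := hub ⟨T, hT.ne', rfl⟩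
      omega
  · rintro ⟨⟨S, hS, hk⟩, hub⟩
    refine (isGreatest_sc G).unique ⟨⟨S, hS.ne', by omega⟩, ?_⟩
    rintro _ ⟨T, hT, rfl⟩
    have := hub T
    omega

theorem toughness_eq_one_iff [Finite V] (G : SimpleGraph V) :
    toughness G = 1 ↔ (∃ S : Set V, 1 < numComp G S ∧ Nat.card S = numComp G S) ∧
      ∀ S : Set V, 1 < numComp G S → numComp G S ≤ Nat.card S := by
  have pos {S : Set V} (hS : 1 < numComp G S) : (0 : ℝ) < numComp G S := by
    exact_mod_cast zero_lt_one.trans hS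
  constructor
  · intro h
    have hne : ∃ S : Set V, 1 < numComp G S := by
      by_contra! hlt
      have : toughness G = 0 := by simp [toughness, (hlt _).not_gt]
      linarith
    obtain ⟨⟨S, hS, hk⟩, hlb⟩ := h ▸ isLeast_toughness G hne
    refine ⟨⟨S, hS, ?_⟩, fun T hT => ?_⟩
    · exact_mod_cast (div_eq_one_iff_eq (pos hS).ne').mp hk.symm
    · exact_mod_cast (one_le_div (pos hT)).mp (hlb ⟨T, hT, rfl⟩)
  · rintro ⟨⟨S, hS, hk⟩, hlb⟩
    refine (isLeast_toughness G ⟨S, hS⟩).unique ⟨⟨S, hS, ?_⟩, ?_⟩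
    · rw [hk, div_self (pos hS).ne']
    · rintro _ ⟨T, hT, rfl⟩
      exact (one_le_div (pos hT)).mpr (by exact_mod_cast hlb T hT)

theorem statement11 {V : Type*} [Finite V] (G : SimpleGraph V)
    (hsc : StrictlyChordal G) (hnc : G ≠ ⊤) :
    sc G = 0 ↔ toughness G = 1 := by
  have := hsc.1.nonempty
  rw [sc_eq_zero_iff, toughness_eq_one_iff]
end

section
/- Let G be a non-complete strictly chordal graph with τ(G) < 1 such that every minimal vertex separator S of G satisfies |S| ≥ μ(S), i.e., |S| ≥ ω(G−S) − 1 (a type A graph). Then sc(G) = 1. -/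
open SimpleGraph

variable {V : Type*}

/-- `a` and `b` lie outside `S` and in the same component of `G - S`. -/
def JoinedOff {V : Type*} (G : SimpleGraph V) (S : Set V) (a b : V) : Prop :=
  ∃ (ha : a ∈ Sᶜ) (hb : b ∈ Sᶜ), (G.induce Sᶜ).Reachable ⟨a, ha⟩ ⟨b, hb⟩

namespace JoinedOff

variable {V : Type*} {G : SimpleGraph V} {S T : Set V} {a b c : V}

lemma refl (ha : a ∉ S) : JoinedOff G S a a := ⟨ha, ha, Reachable.refl _⟩

lemma symm (h : JoinedOff G S a b) : JoinedOff G S b a := by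
  obtain ⟨ha, hb, h⟩ := h
  exact ⟨hb, ha, h.symm⟩

lemma trans (h : JoinedOff G S a b) (h' : JoinedOff G S b c) : JoinedOff G S a c := by
  obtain ⟨ha, _, h⟩ := h
  obtain ⟨_, hc, h'⟩ := h'
  exact ⟨ha, hc, h.trans h'⟩

lemma notMem_left (h : JoinedOff G S a b) : a ∉ S := h.1

lemma notMem_right (h : JoinedOff G S a b) : b ∉ S := h.2.1

lemma of_adj (h : G.Adj a b) (ha : a ∉ S) (hb : b ∉ S) : JoinedOff G S a b :=
  ⟨ha, hb, Adj.reachable (G := G.induce Sᶜ) h⟩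

lemma tail (h : JoinedOff G S a b) (hbc : G.Adj b c) (hc : c ∉ S) : JoinedOff G S a c :=
  h.trans (of_adj hbc h.notMem_right hc)

lemma induction_on {P : V → Prop} (h : JoinedOff G S a b) (base : P a)
    (step : ∀ x y, JoinedOff G S a x → P x → G.Adj x y → y ∉ S → P y) : P b := by
  obtain ⟨ha, hb, ⟨w⟩⟩ := h
  have key : ∀ (x y : (Sᶜ : Set V)), (G.induce Sᶜ).Walk x y → JoinedOff G S a x → P x → P y := by
    intro x y w
    induction w with
    | nil => exact fun _ h => h
    | @cons x y z hxy _ ih =>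
      intro hx hP
      have hadj : G.Adj x y := hxy
      exact ih (hx.tail hadj y.2) (step x y hx hP hadj y.2)
  exact key _ _ w (refl ha) base

lemma mono (hST : S ⊆ T) (h : JoinedOff G T a b) : JoinedOff G S a b :=
  h.induction_on (P := JoinedOff G S a) (refl fun ha => h.notMem_left (hST ha))
    fun _ _ _ hx hxy hy => hx.tail hxy fun hy' => hy (hST hy')

/-- A component of `G - S` that misses `T` is still connected in `G - T`. -/
lemma of_forall_notMem (h : JoinedOff G S a b) (hT : ∀ x, JoinedOff G S a x → x ∉ T) :
    JoinedOff G T a b :=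
  h.induction_on (P := JoinedOff G T a) (refl (hT _ (refl h.notMem_left)))
    fun _ _ hx hx' hxy hy => hx'.tail hxy (hT _ (hx.tail hxy hy))

end JoinedOff

section Separators

variable {V : Type*} {G : SimpleGraph V} {S T U : Set V} {a b u v : V}

lemma separatedBy_iff :
    SeparatedBy G S a b ↔ a ∉ S ∧ b ∉ S ∧ ¬ JoinedOff G S a b := by
  constructor
  · rintro ⟨ha, hb, h⟩
    exact ⟨ha, hb, fun ⟨_, _, h'⟩ => h h'⟩
  · rintro ⟨ha, hb, h⟩
    exact ⟨ha, hb, fun h' => h ⟨ha, hb, h'⟩⟩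

lemma SeparatedBy.symm (h : SeparatedBy G S a b) : SeparatedBy G S b a := by
  rw [separatedBy_iff] at *
  exact ⟨h.2.1, h.1, fun h' => h.2.2 h'.symm⟩

lemma SeparatedBy.isMVS (h : SeparatedBy G S a b) (hmin : ∀ T ⊂ S, ¬ SeparatedBy G T a b) :
    IsMVS G S := by
  have h' := separatedBy_iff.1 h
  refine ⟨a, b, ?_, ?_, h, hmin⟩
  · rintro rfl
    exact h'.2.2 (.refl h'.1)
  · exact fun hab => h'.2.2 (.of_adj hab h'.1 h'.2.1)

lemma SeparatedBy.exists_minimal_subset [Finite V] (h : SeparatedBy G S a b) :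
    ∃ T ⊆ S, SeparatedBy G T a b ∧ ∀ T' ⊂ T, ¬ SeparatedBy G T' a b := by
  obtain ⟨T, hTS, hT⟩ := exists_minimal_le_of_wellFoundedLT (SeparatedBy G · a b) S h
  exact ⟨T, hTS, hT.prop, fun T' hT' h' => hT.not_prop_of_lt hT' h'⟩

lemma SeparatedBy.nonempty (hG : G.Connected) (h : SeparatedBy G S a b) : S.Nonempty := by
  rw [Set.nonempty_iff_ne_empty]
  rintro rfl
  refine (separatedBy_iff.1 h).2.2 ?_
  obtain ⟨w⟩ := hG.preconnected a b
  clear h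
  induction w with
  | nil => exact .refl (Set.notMem_empty _)
  | cons hxy _ ih => exact (JoinedOff.of_adj hxy (Set.notMem_empty _) (Set.notMem_empty _)).trans ih

/-- Every vertex of a minimal `uv`-separator has a neighbour in the component of `u`. -/
lemma SeparatedBy.exists_adj_of_minimal (h : SeparatedBy G T u v)
    (hmin : ∀ T' ⊂ T, ¬ SeparatedBy G T' u v) {t : V} (ht : t ∈ T) :
    ∃ x, G.Adj t x ∧ JoinedOff G T u x := by
  obtain ⟨hu, hv, huv⟩ := separatedBy_iff.1 h
  by_contra! hcon
  have hsub : T \ {t} ⊂ T :=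
    Set.sdiff_singleton_ssubset.2 ht
  have hj : JoinedOff G (T \ {t}) u v := by
    by_contra hj
    exact hmin _ hsub (separatedBy_iff.2 ⟨fun h => hu h.1, fun h => hv h.1, hj⟩)
  refine huv (hj.induction_on (P := JoinedOff G T u) (.refl hu) fun x y _ hx hxy hy => ?_)
  refine hx.tail hxy fun hyT => ?_
  obtain rfl : y = t := by
    by_contra hne
    exact hy ⟨hyT, hne⟩
  exact hcon x hxy.symm hx

/-- A set separating two vertices of a minimal `uv`-separator meets the component of `u`. -/
lemma SeparatedBy.exists_mem_joinedOff (h : SeparatedBy G T u v)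
    (hmin : ∀ T' ⊂ T, ¬ SeparatedBy G T' u v) {s t : V} (hs : s ∈ T) (ht : t ∈ T)
    (hst : SeparatedBy G U s t) : ∃ y ∈ U, JoinedOff G T u y := by
  obtain ⟨hsU, htU, hst⟩ := separatedBy_iff.1 hst
  obtain ⟨x, hsx, hx⟩ := h.exists_adj_of_minimal hmin hs
  obtain ⟨y, hty, hy⟩ := h.exists_adj_of_minimal hmin ht
  by_contra! hcon
  have hU : ∀ z, JoinedOff G T u z → z ∉ U := fun z hz hzU => hcon z hzU hz
  have hxy : JoinedOff G U x y :=
    (hx.symm.trans hy).of_forall_notMem fun z hz => hU z (hx.trans hz)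
  exact hst (((JoinedOff.of_adj hsx hsU (hU x hx)).trans hxy).tail hty.symm htU)

/-- If distinct minimal separators are disjoint, then no set separates two vertices of a minimal
separator disjoint from it, unless the two sets cover the graph. -/
lemma SeparatedBy.not_separatedBy_of_disjoint [Finite V] (hG : G.Connected)
    (hdisj : ∀ S S' : Set V, IsMVS G S → IsMVS G S' → S ≠ S' → Disjoint S S')
    (h : SeparatedBy G T u v) (hmin : ∀ T' ⊂ T, ¬ SeparatedBy G T' u v)
    (hTS : Disjoint T S) (haT : a ∉ T) (haS : a ∉ S) {s t : V} (hs : s ∈ T) (ht : t ∈ T) :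
    ¬ SeparatedBy G S s t := by
  intro hst
  obtain ⟨U, hUS, hU, hUmin⟩ := hst.exists_minimal_subset
  have haU : a ∉ U := fun h => haS (hUS h)
  have hTU : Disjoint T U := hTS.mono_right hUS
  obtain ⟨y, hyU, hy⟩ := h.exists_mem_joinedOff hmin hs ht hU
  obtain ⟨z, hzU, hz⟩ := h.symm.exists_mem_joinedOff
    (fun T' hT' h' => hmin T' hT' h'.symm) hs ht hU
  obtain ⟨r, hrT, hr⟩ : ∃ r ∈ T, ¬ JoinedOff G U a r := by
    by_contra! hcon
    exact (separatedBy_iff.1 hU).2.2 ((hcon s hs).symm.trans (hcon t ht))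
  set W : Set V := {x | x ∈ T ∧ JoinedOff G U a x} ∪ {x | x ∈ U ∧ JoinedOff G T a x}
  have hrW : r ∉ W := by
    rintro (h' | h')
    · exact hr h'.2
    · exact Set.disjoint_left.1 hTU hrT h'.1
  have hsep : SeparatedBy G W a r := by
    refine separatedBy_iff.2 ⟨?_, hrW, fun hj => hr ?_⟩
    · rintro (h' | h')
      · exact haT h'.1
      · exact haU h'.1
    · refine (hj.induction_on (P := fun x => JoinedOff G U a x ∧ JoinedOff G T a x)
        ⟨.refl haU, .refl haT⟩ fun x y _ hx hxy hyW => ?_).1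
      have hyT : y ∉ T := fun hyT =>
        hyW (Or.inl ⟨hyT, hx.1.tail hxy (Set.disjoint_left.1 hTU hyT)⟩)
      have hyj := hx.2.tail hxy hyT
      exact ⟨hx.1.tail hxy fun hyU => hyW (Or.inr ⟨hyU, hyj⟩), hyj⟩
  obtain ⟨X, hXW, hX, hXmin⟩ := hsep.exists_minimal_subset
  have hXT : Disjoint X T := by
    refine hdisj _ _ (hX.isMVS hXmin) (h.isMVS hmin) ?_
    rintro rfl
    exact hrW (hXW hrT)
  have hXU : Disjoint X U := by
    refine hdisj _ _ (hX.isMVS hXmin) (hU.isMVS hUmin) ?_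
    rintro rfl
    have key : ∀ w ∈ X, JoinedOff G T a w := fun w hw =>
      (hXW hw).elim (fun h' => absurd hw (Set.disjoint_left.1 hTU h'.1)) fun h' => h'.2
    exact (separatedBy_iff.1 h).2.2
      (hy.trans ((key y hyU).symm.trans ((key z hzU).trans hz.symm)))
  obtain ⟨w, hw⟩ := hX.nonempty hG
  rcases hXW hw with h' | h'
  · exact Set.disjoint_left.1 hXT hw h'.1
  · exact Set.disjoint_left.1 hXU hw h'.1

end Separators

section Counting

variable {V : Type*} {G : SimpleGraph V} {R S T : Set V}

lemma numComp_le_one [Finite V] (h : ∀ a ∉ S, ∀ b ∉ S, JoinedOff G S a b) :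
    numComp G S ≤ 1 := by
  refine Finite.card_le_one_iff_subsingleton.2 ⟨fun c d => ?_⟩
  induction c, d using ConnectedComponent.ind₂ with
  | _ a b => exact ConnectedComponent.sound (h a a.2 b b.2).2.2

lemma SeparatedBy.one_lt_numComp [Finite V] {a b : V} (h : SeparatedBy G S a b) :
    1 < numComp G S := by
  obtain ⟨ha, hb, h⟩ := h
  refine Finite.one_lt_card_iff_nontrivial.2
    ⟨(G.induce Sᶜ).connectedComponentMk ⟨a, ha⟩, (G.induce Sᶜ).connectedComponentMk ⟨b, hb⟩, ?_⟩
  exact fun h' => h (ConnectedComponent.exact h')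

/-- If `T` lies in one component of `G - R`, and vertices joined both off `R` and off `T` are
joined off `R ∪ T`, then deleting `T` from `G - R` creates at most `ω(G - T) - 1` components. -/
lemma numComp_union_add_one_le [Finite V] (hRT : Disjoint T R) (hT : T.Nonempty)
    (hTR : ∀ s ∈ T, ∀ t ∈ T, JoinedOff G R s t)
    (hjoin : ∀ a ∉ R ∪ T, ∀ b ∉ R ∪ T, JoinedOff G R a b → JoinedOff G T a b →
      JoinedOff G (R ∪ T) a b) :
    numComp G (R ∪ T) + 1 ≤ numComp G T + numComp G R := by
  classical
  obtain ⟨t, ht⟩ := hT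
  have htR : t ∈ Rᶜ := Set.disjoint_left.1 hRT ht
  set C := (G.induce Rᶜ).connectedComponentMk ⟨t, htR⟩
  let f : (G.induce (R ∪ T)ᶜ).ConnectedComponent → (G.induce Rᶜ).ConnectedComponent :=
    ConnectedComponent.map
      (induceHomOfLE G (Set.compl_subset_compl.2 Set.subset_union_left)).toHom
  let g : (G.induce (R ∪ T)ᶜ).ConnectedComponent → (G.induce Tᶜ).ConnectedComponent :=
    ConnectedComponent.map
      (induceHomOfLE G (Set.compl_subset_compl.2 Set.subset_union_right)).toHom
  let φ : (G.induce (R ∪ T)ᶜ).ConnectedComponent →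
      (G.induce Tᶜ).ConnectedComponent ⊕ {c : (G.induce Rᶜ).ConnectedComponent // c ≠ C} :=
    fun c => if h : f c = C then Sum.inl (g c) else Sum.inr ⟨f c, h⟩
  have hφ : Function.Injective φ := by
    intro c d hcd
    induction c, d using ConnectedComponent.ind₂ with
    | _ a b =>
    have hf : ∀ h : f (connectedComponentMk _ a) = f (connectedComponentMk _ b),
        JoinedOff G R a b := fun h => ⟨_, _, ConnectedComponent.exact h⟩
    refine ConnectedComponent.sound (?_ : JoinedOff G (R ∪ T) a b).2.2
    by_cases ha : f (connectedComponentMk _ a) = C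
    · by_cases hb : f (connectedComponentMk _ b) = C
      · simp only [φ, ha, hb, dite_true, Sum.inl.injEq] at hcd
        exact hjoin a a.2 b b.2 (hf (ha.trans hb.symm)) ⟨_, _, ConnectedComponent.exact hcd⟩
      · simp [φ, ha, hb] at hcd
    · by_cases hb : f (connectedComponentMk _ b) = C
      · simp [φ, ha, hb] at hcd
      · simp only [φ, ha, hb, dite_false, Sum.inr.injEq, Subtype.mk.injEq] at hcd
        refine (hf hcd).of_forall_notMem fun x hx hxRT => ?_
        rcases hxRT with hxR | hxT
        · exact hx.notMem_right hxR
        · exact ha (ConnectedComponent.sound (hx.trans (hTR x hxT t ht)).2.2)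
  have hle := Nat.card_le_card_of_injective φ hφ
  have hsum : Nat.card {c : (G.induce Rᶜ).ConnectedComponent // c ≠ C} + 1 = numComp G R := by
    have := Fintype.ofFinite (G.induce Rᶜ).ConnectedComponent
    have hpos : 0 < Fintype.card (G.induce Rᶜ).ConnectedComponent := Fintype.card_pos_iff.2 ⟨C⟩
    rw [numComp, Nat.card_eq_fintype_card, Nat.card_eq_fintype_card, Fintype.card_subtype_compl,
      Fintype.card_subtype_eq]
    omega
  rw [Nat.card_sum] at hle
  unfold numComp at *
  omega

/-- In a connected graph with pairwise disjoint minimal separators `T`, each satisfying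
`ω(G - T) ≤ |T| + 1`, every vertex set satisfies the same inequality. -/
lemma numComp_le_card_add_one [Finite V] (hG : G.Connected)
    (hdisj : ∀ S S' : Set V, IsMVS G S → IsMVS G S' → S ≠ S' → Disjoint S S')
    (hA : ∀ S : Set V, IsMVS G S → numComp G S ≤ Nat.card S + 1) (S : Set V) :
    numComp G S ≤ Nat.card S + 1 := by
  induction S using WellFoundedLT.induction with
  | _ S ih =>
  by_cases hS : ∀ a ∉ S, ∀ b ∉ S, JoinedOff G S a b
  · exact (numComp_le_one hS).trans (Nat.le_add_left _ _)
  push Not at hS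
  obtain ⟨a, ha, b, hb, hab⟩ := hS
  obtain ⟨T, hTS, hT, hTmin⟩ := (separatedBy_iff.2 ⟨ha, hb, hab⟩).exists_minimal_subset
  have hTne := hT.nonempty hG
  have hdis : Disjoint T (S \ T) := Set.disjoint_sdiff_right
  have hun : S \ T ∪ T = S := Set.sdiff_union_of_subset hTS
  have hlt : S \ T ⊂ S := by
    refine Set.sdiff_subset.ssubset_of_ne fun h => ?_
    obtain ⟨t, ht⟩ := hTne
    exact (h.symm ▸ hTS ht : t ∈ S \ T).2 ht
  have hle : numComp G (S \ T ∪ T) + 1 ≤ numComp G T + numComp G (S \ T) := by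
    refine numComp_union_add_one_le hdis hTne ?_ ?_
    · intro s hs t ht
      by_contra hst
      exact hT.not_separatedBy_of_disjoint hG hdisj hTmin hdis (fun h => ha (hTS h))
        (fun h => ha h.1) hs ht
        (separatedBy_iff.2 ⟨Set.disjoint_left.1 hdis hs, Set.disjoint_left.1 hdis ht, hst⟩)
    · intro x hx y hy hR hTj
      by_contra hxy
      obtain ⟨U, hUS, hU, hUmin⟩ := (separatedBy_iff.2 ⟨hx, hy, hxy⟩).exists_minimal_subset
      have hUxy := (separatedBy_iff.1 hU).2.2
      have hUT : Disjoint U T := by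
        refine hdisj _ _ (hU.isMVS hUmin) (hT.isMVS hTmin) ?_
        rintro rfl
        exact hUxy hTj
      exact hUxy (hR.mono (hUT.subset_left_of_subset_union hUS))
  have h1 := ih _ hlt
  have h2 := hA T (hT.isMVS hTmin)
  have h3 : Nat.card (S \ T : Set V) + Nat.card T = Nat.card S :=
    Set.ncard_sdiff_add_ncard_of_subset hTS
  rw [hun] at hle
  omega

lemma exists_one_lt_numComp [Finite V] (hG : G ≠ ⊤) : ∃ S : Set V, 1 < numComp G S := by
  obtain ⟨a, b, hne, hab⟩ := ne_top_iff_exists_not_adj.1 hG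
  have hsep : SeparatedBy G ({a, b}ᶜ : Set V) a b := by
    refine separatedBy_iff.2 ⟨by simp, by simp, fun hj => hne ?_⟩
    refine (hj.induction_on (P := fun x => x = a) rfl fun x y _ hx hxy hy => ?_).symm
    subst hx
    rcases not_not.1 hy with h | h
    · exact h
    · rw [Set.mem_singleton_iff.1 h] at hxy
      exact absurd hxy hab
  exact ⟨_, hsep.one_lt_numComp⟩

end Counting

theorem statement12 {V : Type*} [Finite V] (G : SimpleGraph V)
    (hsc : StrictlyChordal G) (hnc : G ≠ ⊤) (ht : toughness G < 1)
    (hA : ∀ S : Set V, IsMVS G S → numComp G S ≤ Nat.card S + 1) :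
    sc G = 1 := by
  have hle := numComp_le_card_add_one hsc.1 hsc.2.2 hA
  have hub : ∀ k ∈ {k : ℤ | ∃ S : Set V, numComp G S ≠ 1 ∧
      k = (numComp G S : ℤ) - (Nat.card S : ℤ)}, k ≤ 1 := by
    rintro k ⟨S, -, rfl⟩
    have := hle S
    omega
  obtain ⟨S₀, hS₀⟩ := exists_one_lt_numComp hnc
  have hne : {t : ℝ | ∃ S : Set V, 1 < numComp G S ∧
      t = (Nat.card S : ℝ) / (numComp G S : ℝ)}.Nonempty := ⟨_, S₀, hS₀, rfl⟩
  obtain ⟨_, ⟨S, hS, rfl⟩, hlt⟩ := exists_lt_of_csInf_lt hne ht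
  have hcard : Nat.card S < numComp G S := by
    rw [div_lt_one (by positivity)] at hlt
    exact_mod_cast hlt
  have hmem : (numComp G S : ℤ) - (Nat.card S : ℤ) ∈ {k : ℤ | ∃ S : Set V, numComp G S ≠ 1 ∧
      k = (numComp G S : ℤ) - (Nat.card S : ℤ)} := ⟨S, hS.ne', rfl⟩
  exact le_antisymm (csSup_le ⟨_, hmem⟩ hub) (le_csSup_of_le ⟨1, hub⟩ hmem (by omega))
end

section
/- Let G be a strictly chordal graph with at least two distinct minimal vertex separators, let SC be a scattering set of G, and let S be a border minimal vertex separator of G (one with |B(S)| = μ(S)). If |S| < |B(S)|, then SC ∪ S is also a scattering set of G. -/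
open SimpleGraph

variable {V : Type*}

theorem SimpleGraph.Reachable.apply_eq_of_adj {W β : Type*} {H : SimpleGraph W} {f : W → β}
    (hf : ∀ x y, H.Adj x y → f x = f y) {x y : W} (h : H.Reachable x y) : f x = f y := by
  obtain ⟨p⟩ := h
  induction p with
  | nil => rfl
  | cons hadj _ ih => exact (hf _ _ hadj).trans ih

/-- Removing a simplicial vertex does not disconnect the remaining vertices. -/
theorem IsSimplicial.reachable_of_diff_singleton {V : Type*} {G : SimpleGraph V} {v : V}
    (hv : IsSimplicial G v) {C : Set V} {u w : V} (hu : u ∈ Cᶜ) (hw : w ∈ Cᶜ)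
    (hu' : u ∈ (C \ {v})ᶜ) (hw' : w ∈ (C \ {v})ᶜ)
    (h : (G.induce (C \ {v})ᶜ).Reachable ⟨u, hu'⟩ ⟨w, hw'⟩) :
    (G.induce Cᶜ).Reachable ⟨u, hu⟩ ⟨w, hw⟩ := by
  classical
  by_cases hvC : v ∈ C
  swap
  · have hC : C \ {v} = C := Set.sdiff_singleton_eq_self hvC
    convert h using 3 <;> simp [hC]
  let f : ↥(C \ {v})ᶜ → (G.induce Cᶜ).ConnectedComponent := fun x =>
    if hx : x.1 ∈ Cᶜ then (G.induce Cᶜ).connectedComponentMk ⟨x, hx⟩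
    else if hn : ∃ y, G.Adj v y ∧ y ∈ Cᶜ then
      (G.induce Cᶜ).connectedComponentMk ⟨hn.choose, hn.choose_spec.2⟩
    else (G.induce Cᶜ).connectedComponentMk ⟨u, hu⟩
  have eq_v : ∀ x : ↥(C \ {v})ᶜ, x.1 ∉ Cᶜ → x.1 = v := by
    rintro ⟨x, hx⟩ h
    simp only [Set.mem_compl_iff, Set.mem_sdiff, Set.mem_singleton_iff, not_and, not_not] at hx h
    exact hx h
  have f_nbr : ∀ x y : ↥(C \ {v})ᶜ, x.1 ∉ Cᶜ → G.Adj x y → f x = f y := by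
    intro x y hx hxy
    have hxv := eq_v x hx
    have hy : y.1 ∈ Cᶜ := by
      by_contra hy
      have hyv := eq_v y hy
      exact hxy.ne (hxv.trans hyv.symm)
    rw [hxv] at hxy
    have hn : ∃ z, G.Adj v z ∧ z ∈ Cᶜ := ⟨y, hxy, hy⟩
    simp only [f, dif_neg hx, dif_pos hn, dif_pos hy, ConnectedComponent.eq]
    by_cases he : hn.choose = y.1
    · have : (⟨hn.choose, hn.choose_spec.2⟩ : ↥Cᶜ) = ⟨y, hy⟩ := Subtype.ext he
      rw [this]
    · exact Adj.reachable (hv hn.choose_spec.1 hxy he)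
  have hf : ∀ x y, (G.induce (C \ {v})ᶜ).Adj x y → f x = f y := by
    intro x y hxy
    by_cases hx : x.1 ∈ Cᶜ
    · by_cases hy : y.1 ∈ Cᶜ
      · simp only [f, dif_pos hx, dif_pos hy, ConnectedComponent.eq]
        exact Adj.reachable hxy
      · exact (f_nbr y x hy hxy.symm).symm
    · exact f_nbr x y hx hxy
  have := h.apply_eq_of_adj hf
  simpa only [f, dif_pos hu, dif_pos hw, ConnectedComponent.eq] using this

theorem IsSimplicial.numComp_le_numComp_diff_singleton {V : Type*} [Finite V] {G : SimpleGraph V}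
    {v : V} (hv : IsSimplicial G v) (C : Set V) : numComp G C ≤ numComp G (C \ {v}) := by
  have hsub : Cᶜ ⊆ (C \ {v})ᶜ := Set.compl_subset_compl.2 Set.sdiff_subset
  refine Nat.card_le_card_of_injective
    (ConnectedComponent.map (G.induceHomOfLE hsub).toHom) ?_
  intro a b
  induction a using ConnectedComponent.ind with | _ a
  induction b using ConnectedComponent.ind with | _ b
  intro h
  simp only [ConnectedComponent.map_mk, ConnectedComponent.eq] at h ⊢
  exact hv.reachable_of_diff_singleton a.2 b.2 (hsub a.2) (hsub b.2) h

theorem IsMVS.not_isSimplicial {V : Type*} {G : SimpleGraph V} {S : Set V} (hS : IsMVS G S)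
    {s : V} (hs : s ∈ S) : ¬ IsSimplicial G s := by
  intro hsimp
  obtain ⟨u, v, -, -, ⟨hu, hv, huv⟩, hmin⟩ := hS
  have hsub : Sᶜ ⊆ (S \ {s})ᶜ := Set.compl_subset_compl.2 Set.sdiff_subset
  refine hmin (S \ {s}) (Set.sdiff_singleton_ssubset.2 hs) ⟨hsub hu, hsub hv, fun h => huv ?_⟩
  exact hsimp.reachable_of_diff_singleton hu hv _ _ h

theorem IsSimplicial.mem_iff_of_isMaxClique {V : Type*} {G : SimpleGraph V} {Q : Set V} {x : V}
    (hx : IsSimplicial G x) (hQ : IsMaxClique G Q) (hxQ : x ∈ Q) {y : V} :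
    y ∈ Q ↔ y = x ∨ G.Adj x y := by
  have hcl : G.IsClique (insert x (G.neighborSet x)) :=
    IsClique.insert hx fun b hb _ => hb
  have hsub : Q ⊆ insert x (G.neighborSet x) := by
    intro z hz
    by_cases h : z = x
    · exact Or.inl h
    · exact Or.inr (hQ.1 hxQ hz (Ne.symm h))
  rw [hQ.2 _ hcl hsub]
  rfl

theorem IsBoundaryClique.isMVS {V : Type*} {G : SimpleGraph V} {Q : Set V}
    (h : IsBoundaryClique G Q) : IsMVS G {v | v ∈ Q ∧ ¬ IsSimplicial G v} := by
  obtain ⟨hQ, ⟨q, hq, hqs⟩, Q', hQ', hne, hinter⟩ := h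
  obtain ⟨q', hq', hq'Q⟩ : ∃ q' ∈ Q', q' ∉ Q := by
    by_contra! hcon
    exact hne (hQ'.2 Q hQ.1 hcon)
  have hnadj : ¬ G.Adj q q' := fun h => hq'Q ((hqs.mem_iff_of_isMaxClique hQ hq).2 (Or.inr h))
  refine ⟨q, q', fun h => hq'Q (h ▸ hq), hnadj, ⟨fun h => h.2 hqs, fun h => hq'Q h.1, ?_⟩, ?_⟩
  · intro hr
    have := hr.apply_eq_of_adj (f := fun x => x.1 ∈ Q) (by
      have key : ∀ x y : ↥{v | v ∈ Q ∧ ¬ IsSimplicial G v}ᶜ, G.Adj x y → x.1 ∈ Q → y.1 ∈ Q := by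
        intro x y hxy hx
        have hxs : IsSimplicial G x := by
          by_contra hcon
          exact x.2 ⟨hx, hcon⟩
        exact (hxs.mem_iff_of_isMaxClique hQ hx).2 (Or.inr hxy)
      intro x y hxy
      exact propext ⟨key x y hxy, key y x hxy.symm⟩)
    exact hq'Q (this.mp hq)
  · rintro T hT ⟨hqT, hq'T, hr⟩
    obtain ⟨t, ht, htT⟩ := Set.exists_of_ssubset hT
    have htQ' : t ∈ Q' := by
      rw [← hinter] at ht
      exact ht.2
    have h1 : G.Adj q t := hQ.1 hq ht.1 fun h => ht.2 (h ▸ hqs)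
    have h2 : G.Adj t q' := hQ'.1 htQ' hq' fun h => hq'Q (h ▸ ht.1)
    have r1 : (G.induce Tᶜ).Adj ⟨q, hqT⟩ ⟨t, htT⟩ := h1
    have r2 : (G.induce Tᶜ).Adj ⟨t, htT⟩ ⟨q', hq'T⟩ := h2
    exact hr (r1.reachable.trans r2.reachable)

theorem le_sc {V : Type*} [Finite V] (G : SimpleGraph V) {S : Set V} (hS : numComp G S ≠ 1) :
    (numComp G S : ℤ) - (Nat.card S : ℤ) ≤ sc G := by
  refine le_csSup ?_ ⟨S, hS, rfl⟩
  refine (Set.Finite.subset (Set.finite_range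
    fun S : Set V => (numComp G S : ℤ) - (Nat.card S : ℤ)) ?_).bddAbove
  rintro k ⟨S, -, rfl⟩
  exact ⟨S, rfl⟩

theorem IsScatteringSet.not_isSimplicial {V : Type*} [Finite V] {G : SimpleGraph V} {C : Set V}
    (hC : IsScatteringSet G C) (h0 : numComp G C ≠ 0) {v : V} (hv : v ∈ C) :
    ¬ IsSimplicial G v := by
  intro hs
  have h1 := hs.numComp_le_numComp_diff_singleton C
  have h2 := hC.1
  have h3 := le_sc G (S := C \ {v}) (by omega)
  have h4 : Nat.card ↥(C \ {v}) + 1 = Nat.card C := by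
    simpa only [Nat.card_coe_set_eq] using Set.ncard_sdiff_singleton_add_one hv
  have h5 := hC.2
  omega

theorem numComp_eq_zero_iff {V : Type*} [Finite V] {G : SimpleGraph V} {C : Set V} :
    numComp G C = 0 ↔ C = Set.univ := by
  rw [numComp, Nat.card_eq_zero]
  constructor
  · rintro (h | h)
    · refine Set.eq_univ_of_forall fun x => ?_
      by_contra hx
      exact h.false ((G.induce Cᶜ).connectedComponentMk ⟨x, hx⟩)
    · exact (not_finite_iff_infinite.2 h inferInstance).elim
  · rintro rfl
    refine Or.inl ⟨fun c => ?_⟩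
    induction c using ConnectedComponent.ind with | _ a
    exact a.2 trivial

/-- Deleting `S` on top of `C` splits off every clique of the family `B` into its own component,
at the expense of at most one component of `G - C`. -/
theorem numComp_add_card_le {V : Type*} [Finite V] {G : SimpleGraph V} {C S : Set V}
    {B : Set (Set V)} {s : V} (hs : s ∈ S) (hsC : s ∉ C) (hcl : G.IsClique S)
    (hQ : ∀ Q ∈ B, IsMaxClique G Q ∧ S ⊆ Q ∧ (∃ v ∈ Q, IsSimplicial G v))
    (hsimp : ∀ Q ∈ B, ∀ v ∈ Q, v ∉ S ↔ IsSimplicial G v)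
    (hC : ∀ v ∈ C, ¬ IsSimplicial G v) :
    numComp G C + Nat.card B ≤ numComp G (C ∪ S) + 1 := by
  classical
  have hsub : (C ∪ S)ᶜ ⊆ Cᶜ := Set.compl_subset_compl.2 Set.subset_union_left
  have huniq : ∀ x ∉ S, ∀ Q ∈ B, ∀ Q' ∈ B, x ∈ Q → x ∈ Q' → Q = Q' := by
    intro x hxS Q hQB Q' hQB' hx hx'
    have hxs := (hsimp Q hQB x hx).1 hxS
    ext y
    rw [hxs.mem_iff_of_isMaxClique (hQ Q hQB).1 hx, hxs.mem_iff_of_isMaxClique (hQ Q' hQB').1 hx']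
  let g : ↥(C ∪ S)ᶜ → (G.induce Cᶜ).ConnectedComponent ⊕ B := fun x =>
    if h : ∃ Q ∈ B, x.1 ∈ Q then Sum.inr ⟨h.choose, h.choose_spec.1⟩
    else Sum.inl ((G.induce Cᶜ).connectedComponentMk ⟨x, hsub x.2⟩)
  have g_mem : ∀ (x : ↥(C ∪ S)ᶜ) (Q : Set V) (hQB : Q ∈ B), x.1 ∈ Q → g x = Sum.inr ⟨Q, hQB⟩ := by
    intro x Q hQB hx
    have h : ∃ Q ∈ B, x.1 ∈ Q := ⟨Q, hQB, hx⟩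
    simp only [g, dif_pos h]
    congr 2
    exact huniq x (fun h => x.2 (Or.inr h)) _ h.choose_spec.1 _ hQB h.choose_spec.2 hx
  have g_nbr : ∀ (x y : ↥(C ∪ S)ᶜ), G.Adj x y → (∃ Q ∈ B, x.1 ∈ Q) → g x = g y := by
    rintro x y hxy ⟨Q, hQB, hx⟩
    have hxs := (hsimp Q hQB x hx).1 fun h => x.2 (Or.inr h)
    have hy := (hxs.mem_iff_of_isMaxClique (hQ Q hQB).1 hx).2 (Or.inr hxy)
    rw [g_mem x Q hQB hx, g_mem y Q hQB hy]
  have hg : ∀ x y, (G.induce (C ∪ S)ᶜ).Adj x y → g x = g y := by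
    intro x y hxy
    by_cases hx : ∃ Q ∈ B, x.1 ∈ Q
    · exact g_nbr x y hxy hx
    by_cases hy : ∃ Q ∈ B, y.1 ∈ Q
    · exact (g_nbr y x hxy.symm hy).symm
    simp only [g, dif_neg hx, dif_neg hy, Sum.inl.injEq, ConnectedComponent.eq]
    exact Adj.reachable (show (G.induce Cᶜ).Adj ⟨x, hsub x.2⟩ ⟨y, hsub y.2⟩ from hxy)
  let F : (G.induce (C ∪ S)ᶜ).ConnectedComponent → (G.induce Cᶜ).ConnectedComponent ⊕ B :=
    Quot.lift g fun _ _ h => h.apply_eq_of_adj hg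
  let F' : Option (G.induce (C ∪ S)ᶜ).ConnectedComponent →
      (G.induce Cᶜ).ConnectedComponent ⊕ B := fun o =>
    o.elim (Sum.inl ((G.induce Cᶜ).connectedComponentMk ⟨s, hsC⟩)) F
  have hF : Function.Surjective F' := by
    rintro (c | ⟨Q, hQB⟩)
    · induction c using ConnectedComponent.ind with | _ a
      by_cases ha : (G.induce Cᶜ).connectedComponentMk ⟨s, hsC⟩ =
          (G.induce Cᶜ).connectedComponentMk a
      · exact ⟨none, congrArg Sum.inl ha⟩
      have hnadj : ¬ G.Adj s a := fun h => ha (ConnectedComponent.eq.2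
        (Adj.reachable (show (G.induce Cᶜ).Adj ⟨s, hsC⟩ a from h)))
      have hne : s ≠ a := by
        rintro rfl
        exact ha rfl
      have haS : a.1 ∉ S := fun h => hnadj (hcl hs h hne)
      have haQ : ¬ ∃ Q ∈ B, a.1 ∈ Q := by
        rintro ⟨Q, hQB, h⟩
        exact hnadj ((hQ Q hQB).1.1 ((hQ Q hQB).2.1 hs) h hne)
      refine ⟨some ((G.induce (C ∪ S)ᶜ).connectedComponentMk ⟨a, fun h => h.elim a.2 haS⟩), ?_⟩
      change g _ = _
      simp only [g, dif_neg haQ]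
    · obtain ⟨v, hv, hvs⟩ := (hQ Q hQB).2.2
      exact ⟨some ((G.induce (C ∪ S)ᶜ).connectedComponentMk
        ⟨v, fun h => h.elim (fun h => hC v h hvs) ((hsimp Q hQB v hv).2 hvs)⟩),
        g_mem _ Q hQB hv⟩
  have := Nat.card_le_card_of_surjective F' hF
  rwa [Nat.card_sum, Finite.card_option] at this

theorem statement14 {V : Type*} [Finite V] (G : SimpleGraph V)
    (hsc : StrictlyChordal G)
    (h2 : ∃ S S' : Set V, IsMVS G S ∧ IsMVS G S' ∧ S ≠ S')
    (SC : Set V) (hSC : IsScatteringSet G SC)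
    (S : Set V) (hS : IsMVS G S)
    (hborder : Nat.card (BS G S) + 1 = numComp G S)
    (hlt : Nat.card S < Nat.card (BS G S)) :
    IsScatteringSet G (SC ∪ S) := by
  by_cases hsub : S ⊆ SC
  · rwa [Set.union_eq_self_of_subset_right hsub]
  obtain ⟨s, hs, hsSC⟩ := Set.not_subset.1 hsub
  have h0 : numComp G SC ≠ 0 := fun h => hsSC (numComp_eq_zero_iff.1 h ▸ Set.mem_univ s)
  have hSQ : ∀ Q ∈ BS G S, S = {v | v ∈ Q ∧ ¬ IsSimplicial G v} := by
    intro Q hQ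
    by_contra hne
    exact Set.disjoint_left.1 (hsc.2.2 _ _ hS hQ.1.isMVS hne) hs ⟨hQ.2 hs, hS.not_isSimplicial hs⟩
  obtain ⟨Q, hQ⟩ : (BS G S).Nonempty := by
    rw [Set.nonempty_iff_ne_empty]
    intro h
    rw [h] at hlt
    simp at hlt
  have hcount := numComp_add_card_le (B := BS G S) hs hsSC (hQ.1.1.1.subset hQ.2)
    (fun Q hQ => ⟨hQ.1.1, hQ.2, hQ.1.2.1⟩)
    (fun Q hQ v hv => by
      conv_lhs => rw [hSQ Q hQ]
      simp [hv])
    (fun v hv => hSC.not_isSimplicial h0 hv)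
  have hcard : Nat.card ↥(SC ∪ S) ≤ Nat.card SC + Nat.card S := by
    simpa only [Nat.card_coe_set_eq] using Set.ncard_union_le SC S
  have hne1 := hSC.1
  have hne : numComp G (SC ∪ S) ≠ 1 := by omega
  refine ⟨hne, le_antisymm (le_sc G hne) ?_⟩
  have := hSC.2
  omega
end

section
/- Let G be a strictly chordal graph and let S′ and S″ be two distinct minimal vertex separators of G, and set 𝐒 = S′ ∪ S″ (so S′ and S″ are disjoint). If 𝐒 is a maximal clique of G, then ω(G−𝐒) = ω(G−S′) + ω(G−S″) − 2; otherwise ω(G−𝐒) = ω(G−S′) + ω(G−S″) − 1. -/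
open SimpleGraph

variable {V : Type*}

/-- `u` and `v` lie outside `S` and in the same connected component of `G - S`. -/
def ReachOff (G : SimpleGraph V) (S : Set V) (u v : V) : Prop :=
  ∃ (hu : u ∈ Sᶜ) (hv : v ∈ Sᶜ), (G.induce Sᶜ).Reachable ⟨u, hu⟩ ⟨v, hv⟩

namespace ReachOff

variable {G : SimpleGraph V} {S T : Set V} {u v w : V}

lemma left (h : ReachOff G S u v) : u ∉ S := h.1

lemma right (h : ReachOff G S u v) : v ∉ S := h.2.1

lemma refl (hu : u ∉ S) : ReachOff G S u u := ⟨hu, hu, Reachable.refl _⟩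

lemma symm (h : ReachOff G S u v) : ReachOff G S v u :=
  ⟨h.2.1, h.1, h.2.2.symm⟩

lemma trans (h : ReachOff G S u v) (h' : ReachOff G S v w) : ReachOff G S u w :=
  ⟨h.1, h'.2.1, h.2.2.trans h'.2.2⟩

lemma of_adj (hu : u ∉ S) (hv : v ∉ S) (h : G.Adj u v) : ReachOff G S u v :=
  ⟨hu, hv, Adj.reachable (by simpa using h)⟩

lemma snoc (h : ReachOff G S u v) (hw : w ∉ S) (hvw : G.Adj v w) : ReachOff G S u w :=
  h.trans (of_adj h.right hw hvw)

lemma induct (h : ReachOff G S u v) (P : V → Prop) (hu : P u)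
    (step : ∀ a b, P a → a ∉ S → b ∉ S → G.Adj a b → P b) : P v := by
  obtain ⟨hu', hv', ⟨p⟩⟩ := h
  have key : ∀ (a b : (Sᶜ : Set V)), (G.induce Sᶜ).Walk a b → P a → P b := by
    intro a b p
    induction p with
    | nil => exact id
    | @cons c d _ hadj _ ih => exact fun ha => ih (step c d ha c.2 d.2 hadj)
  exact key _ _ p hu

lemma transfer (h : ReachOff G S u v) (hT : ∀ w, ReachOff G S u w → w ∉ T) :
    ReachOff G T u v := by
  refine (h.induct (fun w => ReachOff G S u w ∧ ReachOff G T u w)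
    ⟨refl h.left, refl (hT _ (refl h.left))⟩ ?_).2
  rintro a b ⟨h1, h2⟩ _ hb hab
  have h3 := h1.snoc hb hab
  exact ⟨h3, h2.snoc (hT _ h3) hab⟩

lemma mono (h : ReachOff G S u v) (hTS : T ⊆ S) : ReachOff G T u v :=
  h.transfer fun _ hw hwT => hw.right (hTS hwT)

end ReachOff

lemma SimpleGraph.Reachable.reachOff_empty {G : SimpleGraph V} {u v : V} (h : G.Reachable u v) :
    ReachOff G ∅ u v := by
  obtain ⟨p⟩ := h
  induction p with
  | nil => exact .refl (by simp)
  | cons hadj _ ih => exact (ReachOff.of_adj (by simp) (by simp) hadj).trans ih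

lemma separatedBy_iff_s17 {G : SimpleGraph V} {S : Set V} {u v : V} :
    SeparatedBy G S u v ↔ u ∉ S ∧ v ∉ S ∧ ¬ ReachOff G S u v := by
  constructor
  · rintro ⟨hu, hv, h⟩
    exact ⟨hu, hv, fun h' => h h'.2.2⟩
  · rintro ⟨hu, hv, h⟩
    exact ⟨hu, hv, fun h' => h ⟨hu, hv, h'⟩⟩

/-- The vertex sets of the connected components of `G - S`. -/
def componentsOff (G : SimpleGraph V) (S : Set V) : Set (Set V) :=
  {K | ∃ u, u ∉ S ∧ K = {v | ReachOff G S u v}}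

lemma numComp_eq_ncard_componentsOff (G : SimpleGraph V) (S : Set V) :
    numComp G S = (componentsOff G S).ncard := by
  unfold numComp
  rw [← Nat.card_coe_set_eq]
  let f : (G.induce Sᶜ).ConnectedComponent → Set V := fun c =>
    {v | ∃ hv : v ∈ Sᶜ, (G.induce Sᶜ).connectedComponentMk ⟨v, hv⟩ = c}
  have hf : ∀ u : (Sᶜ : Set V),
      f ((G.induce Sᶜ).connectedComponentMk u) = {v | ReachOff G S u v} := by
    intro u
    ext v
    constructor
    · rintro ⟨hv, h⟩
      exact ⟨u.2, hv, (ConnectedComponent.exact h).symm⟩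
    · rintro ⟨hu, hv, h⟩
      exact ⟨hv, ConnectedComponent.sound h.symm⟩
  have hinj : Function.Injective f := by
    intro c d
    induction c using ConnectedComponent.ind with | _ u
    intro h
    have hu : u.1 ∈ f ((G.induce Sᶜ).connectedComponentMk u) := ⟨u.2, rfl⟩
    rw [h] at hu
    exact hu.2
  have hrange : Set.range f = componentsOff G S := by
    ext K
    constructor
    · rintro ⟨c, rfl⟩
      induction c using ConnectedComponent.ind with | _ u
      exact ⟨u, u.2, hf u⟩
    · rintro ⟨u, hu, rfl⟩
      exact ⟨_, hf ⟨u, hu⟩⟩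
  rw [← hrange]
  exact Nat.card_congr (Equiv.ofInjective f hinj)

lemma exists_isMVS_subset [Finite V] {G : SimpleGraph V} {S : Set V} {u v : V} (hne : u ≠ v)
    (hadj : ¬ G.Adj u v) (hu : u ∉ S) (hv : v ∉ S) (h : ¬ ReachOff G S u v) :
    ∃ T ⊆ S, IsMVS G T ∧ u ∉ T ∧ v ∉ T ∧ ¬ ReachOff G T u v := by
  obtain ⟨T, hTS, hT⟩ := exists_minimal_le_of_wellFoundedLT (fun T => SeparatedBy G T u v) S
    (separatedBy_iff_s17.2 ⟨hu, hv, h⟩)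
  exact ⟨T, hTS, ⟨u, v, hne, hadj, hT.prop, fun R hR hsep => hT.not_prop_of_lt hR hsep⟩,
    separatedBy_iff_s17.1 hT.prop⟩

lemma not_reachOff_neighborSet {G : SimpleGraph V} {u v : V} (hne : u ≠ v) :
    ¬ ReachOff G (G.neighborSet u) u v := by
  intro h
  refine hne (h.induct (fun w => u = w) rfl ?_)
  rintro a b rfl _ hb hab
  exact absurd hab hb

lemma exists_isMVS_of_not_adj [Finite V] {G : SimpleGraph V} {u v : V} (hne : u ≠ v)
    (hadj : ¬ G.Adj u v) :
    ∃ T ⊆ G.neighborSet u, IsMVS G T ∧ u ∉ T ∧ v ∉ T ∧ ¬ ReachOff G T u v :=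
  exists_isMVS_subset hne hadj (by simp) (by simpa using hadj) (not_reachOff_neighborSet hne)

lemma exists_adj_of_minimal {G : SimpleGraph V} {S : Set V} {u v x : V}
    (hsep : SeparatedBy G S u v) (hmin : ∀ T ⊂ S, ¬ SeparatedBy G T u v) (hx : x ∈ S) :
    (∃ p, ReachOff G S u p ∧ G.Adj p x) ∧ ∃ q, ReachOff G S v q ∧ G.Adj q x := by
  obtain ⟨hu, hv, hsep⟩ := separatedBy_iff_s17.1 hsep
  have hT := hmin (S \ {x}) ⟨Set.sdiff_subset, fun h => (h hx).2 rfl⟩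
  have hr : ReachOff G (S \ {x}) u v := by
    by_contra h
    exact hT (separatedBy_iff_s17.2 ⟨fun h => hu h.1, fun h => hv h.1, h⟩)
  have key : ∀ a b, a ∉ S → ¬ ReachOff G S a b → ReachOff G (S \ {x}) a b →
      ∃ p, ReachOff G S a p ∧ G.Adj p x := by
    intro a b ha hab hr
    by_contra! hcon
    refine hab (hr.induct (ReachOff G S a) (.refl ha) ?_)
    intro c d hc _ hd hcd
    have hdx : d ≠ x := by
      rintro rfl
      exact hcon _ hc hcd
    exact hc.snoc (fun h => hd ⟨h, hdx⟩) hcd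
  exact ⟨key u v hu hsep hr, key v u hv (fun h => hsep h.symm) hr.symm⟩

lemma IsChordal.adj_or_adj {G : SimpleGraph V} (hG : IsChordal G) {p x q y : V}
    (hpx : G.Adj p x) (hxq : G.Adj x q) (hqy : G.Adj q y) (hyp : G.Adj y p)
    (hpq : p ≠ q) (hxy : x ≠ y) : G.Adj p q ∨ G.Adj x y := by
  by_contra! h
  obtain ⟨h1, h2⟩ := h
  have h1' : ¬ G.Adj q p := fun h => h1 h.symm
  have h2' : ¬ G.Adj y x := fun h => h2 h.symm
  refine (hG 4 le_rfl).false ⟨⟨![p, x, q, y], ?_⟩, ?_⟩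
  · intro i j hij
    fin_cases i <;> fin_cases j <;>
      simp_all [hpx.ne, hpx.ne', hxq.ne, hxq.ne', hqy.ne, hqy.ne', hyp.ne, hyp.ne', hpq.symm,
        hxy.symm]
  · intro i j
    have hcyc : (cycleGraph 4).Adj i j ↔ i = j + 1 ∨ j = i + 1 := by decide +revert
    change G.Adj (![p, x, q, y] i) (![p, x, q, y] j) ↔ _
    rw [hcyc]
    fin_cases i <;> fin_cases j <;>
      simp [hpx, hpx.symm, hxq, hxq.symm, hqy, hqy.symm, hyp, hyp.symm, h1, h1', h2, h2']

namespace StrictlyChordal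

variable {G : SimpleGraph V} {S A B : Set V}

lemma eq_of_mem (hG : StrictlyChordal G) {S T : Set V} (hS : IsMVS G S) (hT : IsMVS G T) {x : V}
    (hxS : x ∈ S) (hxT : x ∈ T) : S = T := by
  by_contra hne
  exact Set.disjoint_left.1 (hG.2.2 S T hS hT hne) hxS hxT

lemma isClique [Finite V] (hG : StrictlyChordal G) (hS : IsMVS G S) : G.IsClique S := by
  intro x hx y hy hxy
  by_contra hadj
  obtain ⟨u, v, -, -, hsep, hmin⟩ := id hS
  obtain ⟨⟨p, hup, hpx⟩, q, hvq, hqx⟩ := exists_adj_of_minimal hsep hmin hx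
  obtain ⟨⟨p', hup', hpy'⟩, q', hvq', hqy'⟩ := exists_adj_of_minimal hsep hmin hy
  obtain ⟨hu, hv, hsep⟩ := separatedBy_iff_s17.1 hsep
  have key : ∀ u v p q q', ¬ ReachOff G S u v → ReachOff G S u p → ReachOff G S v q →
      ReachOff G S v q' → G.Adj p x → G.Adj q x → G.Adj q' y → G.Adj p y := by
    intro u v p q q' huv hup hvq hvq' hpx hqx hqy'
    by_contra hpy
    have hpy_ne : p ≠ y := fun h => hup.right (h ▸ hy)
    obtain ⟨T, hTN, hT, hpT, hyT, hTsep⟩ := exists_isMVS_of_not_adj hpy_ne hpy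
    have hvT : ∀ w, ReachOff G S v w → w ∉ T := fun w hw hwT =>
      huv ((hup.snoc hw.right (hTN hwT)).trans hw.symm)
    by_cases hxT : x ∈ T
    · exact hyT (hG.eq_of_mem hS hT hx hxT ▸ hy)
    · have hqq' : ReachOff G T q q' :=
        (hvq.transfer hvT).symm.trans (hvq'.transfer hvT)
      exact hTsep ((((ReachOff.of_adj hpT hxT hpx).snoc (hvT q hvq) hqx.symm).trans hqq').snoc
        hyT hqy')
  have hpy := key u v p q q' hsep hup hvq hvq' hpx hqx hqy'
  have hqy := key v u q p p' (fun h => hsep h.symm) hvq hup hup' hqx hpx hpy'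
  have hpq : ¬ G.Adj p q := fun h => hsep ((hup.snoc hvq.right h).trans hvq.symm)
  have hpq_ne : p ≠ q := fun h => hsep (hup.trans (h ▸ hvq.symm))
  exact (hG.2.1.adj_or_adj hpx hqx.symm hqy hpy.symm hpq_ne hxy).elim hpq hadj

lemma nonempty (hG : StrictlyChordal G) (hS : IsMVS G S) : S.Nonempty := by
  rw [Set.nonempty_iff_ne_empty]
  rintro rfl
  obtain ⟨u, v, -, -, hsep, -⟩ := hS
  exact (separatedBy_iff_s17.1 hsep).2.2 (hG.1.preconnected u v).reachOff_empty

end StrictlyChordal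

lemma setOf_reachOff_eq {G : SimpleGraph V} {S : Set V} {u v : V} (h : ReachOff G S u v) :
    {w | ReachOff G S u w} = {w | ReachOff G S v w} :=
  Set.ext fun _ => ⟨fun hw => h.symm.trans hw, fun hw => h.trans hw⟩

/-- Some vertex of `K` is adjacent to some vertex of `A`. -/
def Touches (G : SimpleGraph V) (K A : Set V) : Prop :=
  ∃ k ∈ K, ∃ a ∈ A, G.Adj k a

lemma componentsOff_diff_singleton {G : SimpleGraph V} {A B : Set V} (hdisj : Disjoint A B)
    (hB : G.IsClique B) {b : V} (hb : b ∈ B) :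
    componentsOff G A \ {{v | ReachOff G A b v}} =
      {K ∈ componentsOff G (A ∪ B) | ¬ Touches G K B} := by
  have hBA : ∀ c ∈ B, c ∉ A := fun c hc hcA => Set.disjoint_left.1 hdisj hcA hc
  have hbB : ∀ c ∈ B, ReachOff G A b c := by
    intro c hc
    by_cases h : b = c
    · exact h ▸ .refl (hBA b hb)
    · exact .of_adj (hBA b hb) (hBA c hc) (hB hb hc h)
  ext K
  constructor
  · rintro ⟨⟨u, hu, rfl⟩, hK⟩
    have hno : ∀ c ∈ B, ¬ ReachOff G A u c := fun c hc h =>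
      hK (setOf_reachOff_eq (h.trans (hbB c hc).symm))
    have havoid : ∀ w, ReachOff G A u w → w ∉ A ∪ B := by
      rintro w hw (h | h)
      exacts [hw.right h, hno w h hw]
    refine ⟨⟨u, havoid u (.refl hu), Set.ext fun w =>
      ⟨fun hw => hw.transfer havoid, fun hw => hw.mono Set.subset_union_left⟩⟩, ?_⟩
    rintro ⟨k, hk, c, hc, hkc⟩
    exact hno c hc (ReachOff.snoc hk (hBA c hc) hkc)
  · rintro ⟨⟨u, hu, rfl⟩, hK⟩
    have huA : u ∉ A := fun h => hu (Or.inl h)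
    refine ⟨⟨u, huA, Set.ext fun w => ⟨fun hw => hw.mono Set.subset_union_left, fun hw => ?_⟩⟩, ?_⟩
    · refine hw.induct (ReachOff G (A ∪ B) u) (.refl hu) ?_
      intro c d hc _ hd hcd
      exact hc.snoc (fun h => h.elim hd fun h => hK ⟨c, hc, d, h, hcd⟩) hcd
    · intro h
      have : b ∈ {v | ReachOff G A b v} := hbB b hb
      rw [← Set.mem_singleton_iff.1 h] at this
      exact this.right (Or.inr hb)

lemma touches_or_touches {G : SimpleGraph V} (hG : G.Connected) {A B K : Set V}
    (hA : A.Nonempty) (hK : K ∈ componentsOff G (A ∪ B)) : Touches G K A ∨ Touches G K B := by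
  by_contra! h
  obtain ⟨u, hu, rfl⟩ := hK
  obtain ⟨a, ha⟩ := hA
  have : ReachOff G (A ∪ B) u a := by
    refine (hG.preconnected u a).reachOff_empty.induct _ (.refl hu) ?_
    intro c d hc _ _ hcd
    refine hc.snoc ?_ hcd
    rintro (hd | hd)
    exacts [h.1 ⟨c, hc, d, hd, hcd⟩, h.2 ⟨c, hc, d, hd, hcd⟩]
  exact this.right (Or.inl ha)

/-- The components of `G - (A ∪ B)` that have neighbours both in `A` and in `B`. -/
def middleComponents (G : SimpleGraph V) (A B : Set V) : Set (Set V) :=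
  {K ∈ componentsOff G (A ∪ B) | Touches G K A ∧ Touches G K B}

namespace StrictlyChordal

variable {G : SimpleGraph V} {A B : Set V}

lemma numComp_union_add_two [Finite V] (hG : StrictlyChordal G) (hA : IsMVS G A) (hB : IsMVS G B)
    (hne : A ≠ B) :
    numComp G (A ∪ B) + 2 = numComp G A + numComp G B + (middleComponents G A B).ncard := by
  have hdisj := hG.2.2 A B hA hB hne
  obtain ⟨a, ha⟩ := hG.nonempty hA
  obtain ⟨b, hb⟩ := hG.nonempty hB
  have haB : a ∉ B := Set.disjoint_left.1 hdisj ha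
  have hbA : b ∉ A := Set.disjoint_right.1 hdisj hb
  have h1 := componentsOff_diff_singleton hdisj (hG.isClique hB) hb
  have h2 := componentsOff_diff_singleton hdisj.symm (hG.isClique hA) ha
  rw [Set.union_comm B A] at h2
  have e1 := Set.ncard_sdiff_singleton_add_one
    (show {v | ReachOff G A b v} ∈ componentsOff G A from ⟨b, hbA, rfl⟩)
  have e2 := Set.ncard_sdiff_singleton_add_one
    (show {v | ReachOff G B a v} ∈ componentsOff G B from ⟨a, haB, rfl⟩)
  rw [h1] at e1
  rw [h2] at e2
  simp only [numComp_eq_ncard_componentsOff]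
  have hunion : componentsOff G (A ∪ B) =
      ({K ∈ componentsOff G (A ∪ B) | ¬ Touches G K B} ∪
        {K ∈ componentsOff G (A ∪ B) | ¬ Touches G K A}) ∪ middleComponents G A B := by
    ext K
    simp only [middleComponents, Set.mem_union, Set.mem_ofPred_eq]
    tauto
  have hd1 : Disjoint {K ∈ componentsOff G (A ∪ B) | ¬ Touches G K B}
      {K ∈ componentsOff G (A ∪ B) | ¬ Touches G K A} :=
    Set.disjoint_left.2 fun K hK hK' =>
      (touches_or_touches hG.1 ⟨a, ha⟩ hK.1).elim hK'.2 hK.2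
  have hd2 : Disjoint ({K ∈ componentsOff G (A ∪ B) | ¬ Touches G K B} ∪
      {K ∈ componentsOff G (A ∪ B) | ¬ Touches G K A}) (middleComponents G A B) :=
    Set.disjoint_left.2 fun K hK hK' => hK.elim (fun h => h.2 hK'.2.2) fun h => h.2 hK'.2.1
  have e3 := congrArg Set.ncard hunion
  rw [Set.ncard_union_eq hd2, Set.ncard_union_eq hd1] at e3
  omega

lemma middleComponents_subsingleton [Finite V] (hG : StrictlyChordal G) (hA : IsMVS G A)
    (hB : IsMVS G B) (hne : A ≠ B) : (middleComponents G A B).Subsingleton := by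
  rintro _ ⟨⟨x, hx, rfl⟩, hxA, hxB⟩ _ ⟨⟨y, hy, rfl⟩, hyA, hyB⟩
  by_contra hxy
  have hr : ¬ ReachOff G (A ∪ B) x y := fun h => hxy (setOf_reachOff_eq h)
  have hxy_ne : x ≠ y := by
    rintro rfl
    exact hxy rfl
  obtain ⟨T, hTS, hT, -, -, hsep⟩ :=
    exists_isMVS_subset hxy_ne (fun h => hr (.of_adj hx hy h)) hx hy hr
  have key : ∀ C : Set V, IsMVS G C → Touches G {v | ReachOff G (A ∪ B) x v} C →
      Touches G {v | ReachOff G (A ∪ B) y v} C → ¬ Disjoint C T := by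
    rintro C hC ⟨k, hk, c, hc, hkc⟩ ⟨l, hl, d, hd, hld⟩ hCT
    have hcT := Set.disjoint_left.1 hCT hc
    have hdT := Set.disjoint_left.1 hCT hd
    have hcd : ReachOff G T c d := by
      by_cases h : c = d
      · exact h ▸ .refl hcT
      · exact .of_adj hcT hdT (hG.isClique hC hc hd h)
    exact hsep (((ReachOff.mono hk hTS).snoc hcT hkc).trans
      (hcd.trans ((ReachOff.mono hl hTS).snoc hdT hld).symm))
  have hAT : A = T := by
    by_contra h
    exact key A hA hxA hyA (hG.2.2 A T hA hT h)
  have hBT : B = T := by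
    by_contra h
    exact key B hB hxB hyB (hG.2.2 B T hB hT h)
  exact hne (hAT.trans hBT.symm)

lemma middleComponents_eq_empty [Finite V] (hG : StrictlyChordal G) (hA : IsMVS G A)
    (hB : IsMVS G B) (hne : A ≠ B) (hmax : IsMaxClique G (A ∪ B)) :
    middleComponents G A B = ∅ := by
  rw [Set.eq_empty_iff_forall_notMem]
  rintro _ ⟨⟨x, hx, rfl⟩, ⟨k, hk, a, ha, hka⟩, l, hl, b, hb, hlb⟩
  have hdisj := hG.2.2 A B hA hB hne
  have hbA : b ∉ A := Set.disjoint_right.1 hdisj hb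
  have hkS : k ∉ A ∪ B := ReachOff.right hk
  have mem_of_sep : ∀ c d (T : Set V), c ∈ A ∪ B → d ∈ A ∪ B → G.Adj k d → k ∉ T → c ∉ T →
      ¬ ReachOff G T k c → d ∈ T := by
    intro c d T hc hd hkd hkT hcT hsep
    by_contra hdT
    have hkd' := ReachOff.of_adj hkT hdT hkd
    by_cases h : d = c
    · exact hsep (h ▸ hkd')
    · exact hsep (hkd'.snoc hcT (hmax.1 hd hc h))
  have hkb : G.Adj k b := by
    by_contra hkb
    obtain ⟨T, -, hT, hkT, hbT, hsep⟩ :=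
      exists_isMVS_of_not_adj (fun h : k = b => hkS (Or.inr (h ▸ hb))) hkb
    have haT := mem_of_sep b a T (Or.inr hb) (Or.inl ha) hka hkT hbT hsep
    obtain rfl := hG.eq_of_mem hA hT ha haT
    exact hsep (((ReachOff.symm hk).trans hl).mono Set.subset_union_left |>.snoc hbA hlb)
  have hkc : ∀ c ∈ A ∪ B, G.Adj k c := by
    intro c hc
    by_contra hkc
    obtain ⟨T, -, hT, hkT, hcT, hsep⟩ :=
      exists_isMVS_of_not_adj (fun h : k = c => hkS (h ▸ hc)) hkc
    have haT := mem_of_sep c a T hc (Or.inl ha) hka hkT hcT hsep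
    have hbT := mem_of_sep c b T hc (Or.inr hb) hkb hkT hcT hsep
    exact hne ((hG.eq_of_mem hA hT ha haT).trans (hG.eq_of_mem hB hT hb hbT).symm)
  have := hmax.2 (insert k (A ∪ B)) (hmax.1.insert fun c hc _ => hkc c hc) (Set.subset_insert _ _)
  exact hkS (this ▸ Set.mem_insert k _)

lemma middleComponents_nonempty_of_not_isClique [Finite V] (hG : StrictlyChordal G)
    (hA : IsMVS G A) (hB : IsMVS G B) (hcl : ¬ G.IsClique (A ∪ B)) :
    (middleComponents G A B).Nonempty := by
  have hAc := hG.isClique hA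
  have hBc := hG.isClique hB
  obtain ⟨a, ha, b, hb, hab_ne, hab⟩ : ∃ a ∈ A, ∃ b ∈ B, a ≠ b ∧ ¬ G.Adj a b := by
    by_contra! h
    refine hcl ?_
    rintro x (hx | hx) y (hy | hy) hxy
    exacts [hAc hx hy hxy, h x hx y hy hxy, (h y hy x hx hxy.symm).symm, hBc hx hy hxy]
  obtain ⟨T, -, hT, haT, hbT, hsep⟩ := exists_isMVS_of_not_adj hab_ne hab
  have hAT : ∀ c ∈ A, ReachOff G T a c := by
    intro c hc
    by_cases h : a = c
    · exact h ▸ .refl haT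
    · exact .of_adj haT (fun hcT => haT (hG.eq_of_mem hA hT hc hcT ▸ ha)) (hAc ha hc h)
  have hBT : ∀ c ∈ B, ReachOff G T b c := by
    intro c hc
    by_cases h : b = c
    · exact h ▸ .refl hbT
    · exact .of_adj hbT (fun hcT => hbT (hG.eq_of_mem hB hT hc hcT ▸ hb)) (hBc hb hc h)
  have hno : ∀ c ∈ A, ∀ d ∈ B, ¬ G.Adj c d := fun c hc d hd hcd =>
    hsep (((hAT c hc).snoc (hBT d hd).right hcd).trans (hBT d hd).symm)
  have hdisj : b ∉ A := fun h => hsep (hAT b h)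
  by_contra hX
  have hXK : ∀ w, w ∉ A ∪ B → Touches G {v | ReachOff G (A ∪ B) w v} A →
      ¬ Touches G {v | ReachOff G (A ∪ B) w v} B :=
    fun w hw h1 h2 => hX ⟨_, ⟨w, hw, rfl⟩, h1, h2⟩
  have := (hG.1.preconnected a b).reachOff_empty.induct
    (fun w => w ∈ A ∨ w ∉ A ∪ B ∧ ¬ Touches G {v | ReachOff G (A ∪ B) w v} B) (Or.inl ha) ?_
  · rcases this with h | h
    exacts [hdisj h, h.1 (Or.inr hb)]
  intro c d hc _ _ hcd
  by_cases hdA : d ∈ A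
  · exact Or.inl hdA
  refine Or.inr ?_
  rcases hc with hc | ⟨hc, hcB⟩
  · have hd : d ∉ A ∪ B := fun h => h.elim hdA fun h => hno c hc d h hcd
    exact ⟨hd, hXK d hd ⟨d, .refl hd, c, hc, hcd.symm⟩⟩
  · have hd : d ∉ A ∪ B := fun h => h.elim hdA fun h => hcB ⟨c, .refl hc, d, h, hcd⟩
    exact ⟨hd, setOf_reachOff_eq (.of_adj hc hd hcd) ▸ hcB⟩

lemma middleComponents_nonempty [Finite V] (hG : StrictlyChordal G) (hA : IsMVS G A)
    (hB : IsMVS G B) (hmax : ¬ IsMaxClique G (A ∪ B)) : (middleComponents G A B).Nonempty := by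
  by_cases hcl : G.IsClique (A ∪ B)
  · obtain ⟨R, hR, hsub, hne⟩ : ∃ R : Set V, G.IsClique R ∧ A ∪ B ⊆ R ∧ A ∪ B ≠ R := by
      by_contra! h
      exact hmax ⟨hcl, h⟩
    obtain ⟨r, hr, hrS⟩ := Set.exists_of_ssubset (hsub.ssubset_of_ne hne)
    have hadj : ∀ c ∈ A ∪ B, G.Adj r c := fun c hc =>
      hR hr (hsub hc) fun h => hrS (h ▸ hc)
    obtain ⟨a, ha⟩ := hG.nonempty hA
    obtain ⟨b, hb⟩ := hG.nonempty hB
    exact ⟨_, ⟨r, hrS, rfl⟩, ⟨r, .refl hrS, a, ha, hadj a (Or.inl ha)⟩,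
      r, .refl hrS, b, hb, hadj b (Or.inr hb)⟩
  · exact hG.middleComponents_nonempty_of_not_isClique hA hB hcl

end StrictlyChordal

theorem statement17 {V : Type*} [Finite V] (G : SimpleGraph V)
    (hsc : StrictlyChordal G)
    (S' S'' : Set V) (h' : IsMVS G S') (h'' : IsMVS G S'') (hne : S' ≠ S'') :
    Disjoint S' S'' ∧
    (IsMaxClique G (S' ∪ S'') →
      numComp G (S' ∪ S'') + 2 = numComp G S' + numComp G S'') ∧
    (¬ IsMaxClique G (S' ∪ S'') →
      numComp G (S' ∪ S'') + 1 = numComp G S' + numComp G S'') := by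
  have hcount := hsc.numComp_union_add_two h' h'' hne
  refine ⟨hsc.2.2 S' S'' h' h'' hne, fun hmax => ?_, fun hmax => ?_⟩
  · rw [hsc.middleComponents_eq_empty h' h'' hne hmax, Set.ncard_empty] at hcount
    exact hcount
  · obtain ⟨K, hK⟩ := hsc.middleComponents_nonempty h' h'' hmax
    rw [(hsc.middleComponents_subsingleton h' h'' hne).eq_singleton_of_mem hK,
      Set.ncard_singleton] at hcount
    omega
end
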